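/- Let k ≥ 6 be even, ⌊(k-1)/2⌋ + 2 ≤ r < k ≤ n, and write n - 1 = p(k-2) + q with 0 ≤ q ≤ k-3. Then the maximum number of edges of an n-vertex graph with no K_r and no cycle of length at least k equals f(n,k,r) = p·ex(k-1, K_r) + ex(q+1, K_r), attained by p copies of T(k-1, r-1) and one copy of T(q+1, r-1) all sharing a single common vertex. -/

import Mathlib

open SimpleGraph

/-- `exK n r` is the Turán number ex(n, K_r): the maximum number of edges of an
`n`-vertex graph containing no copy of `K_r`. -/
noncomputable def exK (n r : ℕ) : ℕ :=
  sSup {m | ∃ G : SimpleGraph (Fin n), G.CliqueFree r ∧ G.edgeSet.ncard = m}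

/-- `PathOn G u v S`: there is a path of `G` from `u` to `v` whose vertex set is `S`. -/
inductive PathOn {V : Type*} (G : SimpleGraph V) : V → V → Set V → Prop
  | single (u : V) : PathOn G u u {u}
  | cons {u v w : V} {S : Set V} (h : G.Adj u v) (hu : u ∉ S) (p : PathOn G v w S) :
      PathOn G u w (insert u S)

namespace PathOn

variable {V : Type*} {G G' : SimpleGraph V} {u v w x y z : V} {S T : Set V}

theorem mem_left (p : PathOn G u v S) : u ∈ S := by
  cases p <;> simp

theorem mem_right (p : PathOn G u v S) : v ∈ S := by
  induction p with
  | single u => simp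
  | cons h hu p ih => exact Set.mem_insert_of_mem _ ih

theorem mono (hG : G ≤ G') (p : PathOn G u v S) : PathOn G' u v S := by
  induction p with
  | single u => exact single u
  | cons h hu p ih => exact cons (hG h) hu ih

theorem append (p : PathOn G u v S) (q : PathOn G v w T) (h : S ∩ T ⊆ {v}) :
    PathOn G u w (S ∪ T) := by
  induction p with
  | single u =>
    rwa [Set.singleton_union, Set.insert_eq_of_mem q.mem_left]
  | @cons u y v S hadj hu p ih =>
    rw [Set.insert_union]
    refine cons hadj ?_ (ih q fun a ha => h ⟨Or.inr ha.1, ha.2⟩)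
    rintro (hS | hT)
    · exact hu hS
    · have : u = v := h ⟨Or.inl rfl, hT⟩
      exact hu (this ▸ p.mem_right)

theorem link (p : PathOn G u v S) (h : G.Adj v w) (q : PathOn G w z T) (hd : Disjoint S T) :
    PathOn G u z (S ∪ T) := by
  have hv : v ∉ T := fun hT => Set.disjoint_left.1 hd p.mem_right hT
  have := p.append (cons h hv q) (by
    rintro a ⟨ha, rfl | hT⟩
    · rfl
    · exact (Set.disjoint_left.1 hd ha hT).elim)
  rwa [Set.union_insert, Set.insert_eq_of_mem (Set.mem_union_left _ p.mem_right)] at this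

theorem concat (p : PathOn G u v S) (h : G.Adj v w) (hw : w ∉ S) :
    PathOn G u w (insert w S) := by
  have := p.link h (single w) (Set.disjoint_singleton_right.2 hw)
  rwa [Set.union_singleton] at this

theorem symm (p : PathOn G u v S) : PathOn G v u S := by
  induction p with
  | single u => exact single u
  | cons h hu p ih => exact ih.concat h.symm hu

theorem split (p : PathOn G u v S) (hz : z ∈ S) :
    ∃ S₁ S₂, PathOn G u z S₁ ∧ PathOn G z v S₂ ∧ S₁ ∪ S₂ = S ∧ S₁ ∩ S₂ = {z} := by
  induction p with
  | single u =>
    obtain rfl : z = u := hz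
    exact ⟨{z}, {z}, single z, single z, by simp, by simp⟩
  | @cons u y v S hadj hu p ih =>
    by_cases hzu : z = u
    · subst hzu
      exact ⟨{z}, insert z S, single z, cons hadj hu p, by simp, by simp⟩
    · obtain ⟨S₁, S₂, p₁, p₂, rfl, hi⟩ := ih (hz.resolve_left hzu)
      refine ⟨insert u S₁, S₂, cons hadj (fun h => hu (Or.inl h)) p₁, p₂, Set.insert_union .., ?_⟩
      rw [Set.insert_inter_of_notMem (fun h => hu (Or.inr h)), hi]

theorem finite (p : PathOn G u v S) : S.Finite := by
  induction p with
  | single u => exact Set.finite_singleton u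
  | cons h hu p ih => exact ih.insert _

theorem exists_walk (p : PathOn G u v S) :
    ∃ q : G.Walk u v, q.IsPath ∧ (∀ x, x ∈ q.support ↔ x ∈ S) ∧ q.length + 1 = S.ncard := by
  induction p with
  | single u => exact ⟨.nil, by simp, by simp, by simp⟩
  | cons h hu p ih =>
    obtain ⟨q, hq, hs, hl⟩ := ih
    refine ⟨.cons h q, ?_, ?_, ?_⟩
    · rw [Walk.cons_isPath_iff, hs]
      exact ⟨hq, hu⟩
    · intro x
      simp [hs]
    · rw [Walk.length_cons, hl, Set.ncard_insert_of_notMem hu p.finite]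

theorem of_embedding {W : Type*} {H : SimpleGraph W} (f : H ↪g G) {a b : W} {A : Set W}
    (p : PathOn H a b A) : PathOn G (f a) (f b) (f '' A) := by
  induction p with
  | single u => simpa using single (G := G) (f u)
  | cons h hu p ih =>
    rw [Set.image_insert_eq]
    exact cons (f.map_adj_iff.2 h) (by simpa using hu) ih

theorem exists_enum (p : PathOn G u v S) :
    ∃ (f : ℕ → V) (M : ℕ), f 0 = u ∧ f M = v ∧ M + 1 = S.ncard ∧
      (∀ i ≤ M, ∀ j ≤ M, f i = f j → i = j) ∧ (∀ i < M, G.Adj (f i) (f (i + 1))) ∧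
      ∀ x, x ∈ S ↔ ∃ i ≤ M, f i = x := by
  obtain ⟨q, hq, hs, hl⟩ := p.exists_walk
  refine ⟨q.getVert, q.length, by simp, by simp, hl, ?_, fun i hi => q.adj_getVert_succ hi, ?_⟩
  · intro i hi j hj h
    exact hq.getVert_injOn hi hj h
  · intro x
    rw [← hs, Walk.mem_support_iff_exists_getVert]
    constructor
    · rintro ⟨n, h, hn⟩
      exact ⟨n, hn, h⟩
    · rintro ⟨n, h, hn⟩
      exact ⟨n, hn, h⟩

theorem segment {f : ℕ → V} {M : ℕ} (hinj : ∀ i ≤ M, ∀ j ≤ M, f i = f j → i = j)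
    (hadj : ∀ i < M, G.Adj (f i) (f (i + 1))) {i j : ℕ} (hij : i ≤ j) (hj : j ≤ M) :
    PathOn G (f i) (f j) (f '' Set.Icc i j) := by
  induction j, hij using Nat.le_induction with
  | base => simpa using single (f i)
  | succ j hij ih =>
    have h1 := (ih (by omega)).concat (hadj j (by omega)) (by
      rintro ⟨l, ⟨-, hl⟩, h⟩
      have := hinj l (by omega) (j + 1) hj h
      omega)
    rwa [← Set.image_insert_eq, Set.insert_Icc_right_eq_Icc_add_one (by omega)] at h1

/-- A path on `S` and a path on `T` with the same two ends and nothing else in common form a cycle: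
it contains a path on `S ∪ T` with adjacent ends. -/
theorem close (p : PathOn G x y S) (q : PathOn G x y T) (hxy : x ≠ y) (h : S ∩ T ⊆ {x, y}) :
    ∃ a b, PathOn G a b (S ∪ T) ∧ G.Adj a b := by
  cases q with
  | single u => exact (hxy rfl).elim
  | @cons _ v _ T' hadj hx q =>
    refine ⟨v, x, ?_, hadj.symm⟩
    have := q.append p.symm (by
      rintro a ⟨h1, h2⟩
      rcases h ⟨h2, Or.inr h1⟩ with rfl | h3
      · exact (hx h1).elim
      · exact h3)
    rwa [Set.union_insert, Set.insert_eq_of_mem (Set.mem_union_left _ p.mem_left), Set.union_comm]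

end PathOn

/-- `G` has no path on at least `k` vertices with adjacent ends; for `k ≥ 3` this says that `G` has
no cycle of length at least `k`. -/
def NoLongCycle {V : Type*} (G : SimpleGraph V) (k : ℕ) : Prop :=
  ∀ u v S, PathOn G u v S → G.Adj u v → S.ncard < k

/-- Deleting any one vertex leaves all the other vertices connected to each other. -/
def Unseparable {V : Type*} (G : SimpleGraph V) : Prop :=
  ∀ c x y, x ≠ c → y ≠ c → ∃ S, PathOn G x y S ∧ c ∉ S

section Linkage

variable {V : Type*} {G : SimpleGraph V}

theorem PathOn.exists_minimal {x y : V} {S X Y : Set V} (p : PathOn G x y S) (hx : x ∈ X)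
    (hy : y ∈ Y) :
    ∃ z w T, PathOn G z w T ∧ T ⊆ S ∧ T ∩ X = {z} ∧ T ∩ Y = {w} := by
  induction hn : S.ncard using Nat.strong_induction_on generalizing x y S with
  | _ n ih =>
    by_cases h1 : ∃ z ∈ S ∩ X, z ≠ x
    · obtain ⟨z, ⟨hz, hzX⟩, hne⟩ := h1
      obtain ⟨S₁, S₂, p₁, p₂, hu, hi⟩ := p.split hz
      have hlt : S₂.ncard < n := by
        rw [← hn]
        refine Set.ncard_lt_ncard ⟨hu ▸ Set.subset_union_right, fun h => hne ?_⟩ p.finite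
        have : x ∈ S₁ ∩ S₂ := ⟨p₁.mem_left, h p.mem_left⟩
        rw [hi] at this
        exact this.symm
      obtain ⟨z', w, T, q, hT, h⟩ := ih _ hlt p₂ hzX hy rfl
      exact ⟨z', w, T, q, hT.trans (hu ▸ Set.subset_union_right), h⟩
    by_cases h2 : ∃ z ∈ S ∩ Y, z ≠ y
    · obtain ⟨z, ⟨hz, hzY⟩, hne⟩ := h2
      obtain ⟨S₁, S₂, p₁, p₂, hu, hi⟩ := p.split hz
      have hlt : S₁.ncard < n := by
        rw [← hn]
        refine Set.ncard_lt_ncard ⟨hu ▸ Set.subset_union_left, fun h => hne ?_⟩ p.finite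
        have : y ∈ S₁ ∩ S₂ := ⟨h p.mem_right, p₂.mem_right⟩
        rw [hi] at this
        exact this.symm
      obtain ⟨z', w, T, q, hT, h⟩ := ih _ hlt p₁ hx hzY rfl
      exact ⟨z', w, T, q, hT.trans (hu ▸ Set.subset_union_left), h⟩
    push Not at h1 h2
    exact ⟨x, y, S, p, subset_rfl,
      Set.Subset.antisymm (fun a ha => h1 a ha) (by rintro a rfl; exact ⟨p.mem_left, hx⟩),
      Set.Subset.antisymm (fun a ha => h2 a ha) (by rintro a rfl; exact ⟨p.mem_right, hy⟩)⟩

theorem Unseparable.exists_ear (hG : Unseparable G) {c x y : V} {X Y : Set V} (hx : x ∈ X)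
    (hy : y ∈ Y) (hcX : c ∉ X) (hcY : c ∉ Y) :
    ∃ z w T, PathOn G z w T ∧ c ∉ T ∧ T ∩ X = {z} ∧ T ∩ Y = {w} := by
  obtain ⟨S, p, hc⟩ := hG c x y (by rintro rfl; exact hcX hx) (by rintro rfl; exact hcY hy)
  obtain ⟨z, w, T, q, hT, h⟩ := p.exists_minimal hx hy
  exact ⟨z, w, T, q, fun h => hc (hT h), h⟩

/-- Along a path `f 0, …, f M`, two disjoint paths lead from the initial segment `f 0, …, f u` to
the final segment `f j, …, f M`; one of them starts at `f u`, one of them ends at `f j`. -/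
theorem Unseparable.exists_linkage (hG : Unseparable G) {f : ℕ → V} {M u : ℕ}
    (hinj : ∀ i ≤ M, ∀ j ≤ M, f i = f j → i = j) (hadj : ∀ i < M, G.Adj (f i) (f (i + 1)))
    (hu : 1 ≤ u) {j : ℕ} (huj : u ≤ j) (hj : j < M) :
    ∃ s t b b' R R', s < u ∧ j < t ∧ t ≤ M ∧ (b = u ∧ b' = s ∨ b = s ∧ b' = u) ∧
      PathOn G (f b) (f j) R ∧ PathOn G (f b') (f t) R' ∧ Disjoint R R' ∧
      R ∩ f '' Set.Icc 0 u ⊆ {f b} ∧ R' ∩ f '' Set.Icc 0 u ⊆ {f b'} ∧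
      R ∩ f '' Set.Icc j M ⊆ {f j} ∧ R' ∩ f '' Set.Icc j M ⊆ {f t} := by
  induction j, huj using Nat.le_induction with
  | base =>
    have hne : ∀ i ≤ M, i ≠ u → f i ≠ f u := fun i hi h h' => h (hinj i hi u hj.le h')
    obtain ⟨z, w, T, p, hc, hX, hY⟩ := hG.exists_ear (c := f u) (x := f 0) (y := f M)
      (X := f '' Set.Ico 0 u) (Y := f '' Set.Ioc u M) ⟨0, ⟨by omega, by omega⟩, rfl⟩
      ⟨M, ⟨by omega, by omega⟩, rfl⟩
      (by rintro ⟨i, hi, h⟩; exact hne i (by have := hi.2; omega) (by have := hi.2; omega) h)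
      (by rintro ⟨i, hi, h⟩; exact hne i hi.2 (by have := hi.1; omega) h)
    obtain ⟨s, ⟨-, hs⟩, rfl⟩ : z ∈ f '' Set.Ico 0 u := (hX.symm ▸ rfl : z ∈ T ∩ _).2
    obtain ⟨t, ht, rfl⟩ : w ∈ f '' Set.Ioc u M := (hY.symm ▸ rfl : w ∈ T ∩ _).2
    refine ⟨s, t, u, s, {f u}, T, hs, ht.1, ht.2, Or.inl ⟨rfl, rfl⟩, .single _, p,
      Set.disjoint_singleton_left.2 hc, Set.inter_subset_left, ?_, Set.inter_subset_left, ?_⟩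
    · rintro a ⟨ha, i, hi, rfl⟩
      rw [← hX]
      refine ⟨ha, i, ⟨hi.1, lt_of_le_of_ne hi.2 ?_⟩, rfl⟩
      rintro rfl
      exact hc ha
    · rintro a ⟨ha, i, hi, rfl⟩
      rw [← hY]
      refine ⟨ha, i, ⟨lt_of_le_of_ne hi.1 ?_, hi.2⟩, rfl⟩
      rintro rfl
      exact hc ha
  | succ j huj ih =>
    obtain ⟨s, t, b, b', R, R', hs, ht, htM, hb, p, p', hd, hL, hL', hY, hY'⟩ := ih (by omega)
    rw [Set.disjoint_left] at hd
    set c := f (j + 1) with hc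
    set L := f '' Set.Icc 0 u with hLdef
    set Y := f '' Set.Icc (j + 1) M with hYdef
    have hYsub : Y ⊆ f '' Set.Icc j M := Set.image_mono (Set.Icc_subset_Icc_left (by omega))
    have hjY : f j ∉ Y := by
      rintro ⟨i, hi, h⟩
      have := hinj i hi.2 j (by omega) h
      have := hi.1
      omega
    have hcY : c ∈ Y := ⟨j + 1, ⟨le_rfl, by omega⟩, rfl⟩
    have hcL : c ∉ L := by
      rintro ⟨i, hi, h⟩
      have := hi.2
      have := hinj i (by omega) (j + 1) (by omega) h
      omega
    have hRY : ∀ a ∈ R, a ∉ Y := by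
      intro a ha haY
      have : a = f j := hY ⟨ha, hYsub haY⟩
      exact hjY (this ▸ haY)
    have hcR : c ∉ R := fun h => hRY c h hcY
    have hR'Y : ∀ a ∈ R', a ∈ Y → a = f t := fun a ha haY => hY' ⟨ha, hYsub haY⟩
    have q : PathOn G (f b) c (insert c R) := p.concat (hadj j (by omega)) hcR
    have hLc : insert c R ∩ L ⊆ {f b} := by
      rintro a ⟨rfl | ha, haL⟩
      · exact (hcL haL).elim
      · exact hL ⟨ha, haL⟩
    have hYc : insert c R ∩ Y ⊆ {c} := by
      rintro a ⟨rfl | ha, haY⟩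
      · rfl
      · exact (hRY a ha haY).elim
    by_cases htj : t = j + 1
    · subst htj
      have hcR' : c ∈ R' := p'.mem_right
      obtain ⟨z, w, T, e, hcT, hTX, hTY⟩ := hG.exists_ear (c := c) (x := f 0) (y := f M)
        (X := (L ∪ R ∪ R') \ {c}) (Y := Y \ {c})
        ⟨Or.inl (Or.inl ⟨0, ⟨by omega, by omega⟩, rfl⟩), fun h => by
          have := hinj 0 (by omega) (j + 1) (by omega) h
          omega⟩
        ⟨⟨M, ⟨by omega, le_rfl⟩, rfl⟩, fun h => by
          have := hinj M (by omega) (j + 1) (by omega) h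
          omega⟩ (fun h => h.2 rfl) (fun h => h.2 rfl)
      have hzX : z ∈ T ∩ ((L ∪ R ∪ R') \ {c}) := hTX.symm ▸ rfl
      have hwY : w ∈ T ∩ (Y \ {c}) := hTY.symm ▸ rfl
      have hTX' : ∀ a ∈ T, a ∈ L ∪ R ∪ R' → a = z := fun a ha h => by
        have : a ∈ T ∩ ((L ∪ R ∪ R') \ {c}) := ⟨ha, h, by rintro rfl; exact hcT ha⟩
        rwa [hTX] at this
      have hTY' : ∀ a ∈ T, a ∈ Y → a = w := fun a ha h => by
        have : a ∈ T ∩ (Y \ {c}) := ⟨ha, h, by rintro rfl; exact hcT ha⟩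
        rwa [hTY] at this
      obtain ⟨t, ht', rfl⟩ : w ∈ Y := hwY.2.1
      have htlt : j + 1 < t := lt_of_le_of_ne ht'.1 (by rintro rfl; exact hwY.2.2 rfl)
      by_cases hzR : z ∈ R
      · obtain ⟨S₁, S₂, p₁, -, hun, hin⟩ := p.split hzR
        have hS : S₁ ⊆ R := hun ▸ Set.subset_union_left
        refine ⟨s, t, b', b, R', S₁ ∪ T, hs, htlt, ht'.2, by tauto, p', p₁.append e ?_, ?_, hL', ?_,
          ?_, ?_⟩
        · rintro a ⟨h1, h2⟩
          exact hTX' a h2 (Or.inl (Or.inr (hS h1)))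
        · rw [Set.disjoint_left]
          rintro a h1 (h2 | h2)
          · exact hd (hS h2) h1
          · have := hTX' a h2 (Or.inr h1)
            exact hd (this ▸ hzR) h1
        · rintro a ⟨h1 | h1, h2⟩
          · exact hL ⟨hS h1, h2⟩
          · have := hTX' a h1 (Or.inl (Or.inl h2))
            exact hL ⟨this ▸ hzR, h2⟩
        · rintro a ⟨h1, h2⟩
          exact hR'Y a h1 h2
        · rintro a ⟨h1 | h1, h2⟩
          · exact (hRY a (hS h1) h2).elim
          · exact hTY' a h1 h2
      by_cases hzR' : z ∈ R'
      · obtain ⟨S₁, S₂, p₁, p₂, hun, hin⟩ := p'.split hzR'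
        have hS : S₁ ⊆ R' := hun ▸ Set.subset_union_left
        have hcS : c ∉ S₁ := fun h => by
          have : c ∈ S₁ ∩ S₂ := ⟨h, p₂.mem_right⟩
          rw [hin] at this
          exact hzX.2.2 this.symm
        refine ⟨s, t, b, b', insert c R, S₁ ∪ T, hs, htlt, ht'.2, hb, q, p₁.append e ?_, ?_, hLc,
          ?_, hYc, ?_⟩
        · rintro a ⟨h1, h2⟩
          exact hTX' a h2 (Or.inr (hS h1))
        · rw [Set.disjoint_left]
          rintro a (rfl | h1) (h2 | h2)
          · exact hcS h2
          · exact hcT h2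
          · exact hd h1 (hS h2)
          · have := hTX' a h2 (Or.inl (Or.inr h1))
            exact hzR (this ▸ h1)
        · rintro a ⟨h1 | h1, h2⟩
          · exact hL' ⟨hS h1, h2⟩
          · have := hTX' a h1 (Or.inl (Or.inl h2))
            exact hL' ⟨this ▸ hzR', h2⟩
        · rintro a ⟨h1 | h1, h2⟩
          · have : a = c := hR'Y a (hS h1) h2
            exact (hcS (this ▸ h1)).elim
          · exact hTY' a h1 h2
      · obtain ⟨s', hs', rfl⟩ : z ∈ L := by
          rcases hzX.2.1 with (h | h) | h
          exacts [h, (hzR h).elim, (hzR' h).elim]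
        have hTL : T ∩ L ⊆ {f s'} := fun a ha => hTX' a ha.1 (Or.inl (Or.inl ha.2))
        have hTY'' : T ∩ Y ⊆ {f t} := fun a ha => hTY' a ha.1 ha.2
        rcases hb with ⟨rfl, rfl⟩ | ⟨rfl, rfl⟩
        · have : s' ≠ b := by
            rintro rfl
            exact hzR p.mem_left
          refine ⟨s', t, b, s', insert c R, T, lt_of_le_of_ne hs'.2 this, htlt, ht'.2,
            Or.inl ⟨rfl, rfl⟩, q, e, ?_, hLc, hTL, hYc, hTY''⟩
          rw [Set.disjoint_left]
          rintro a (rfl | h1) h2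
          · exact hcT h2
          · have := hTX' a h2 (Or.inl (Or.inr h1))
            exact hzR (this ▸ h1)
        · have : s' ≠ b' := by
            rintro rfl
            exact hzR' p'.mem_left
          refine ⟨s', t, b', s', R', T, lt_of_le_of_ne hs'.2 this, htlt, ht'.2,
            Or.inl ⟨rfl, rfl⟩, p', e, ?_, hL', hTL, fun a h => hR'Y a h.1 h.2, hTY''⟩
          rw [Set.disjoint_left]
          intro a h1 h2
          have := hTX' a h2 (Or.inr h1)
          exact hzR' (this ▸ h1)
    · refine ⟨s, t, b, b', insert c R, R', hs, by omega, htM, hb, q, p', ?_, hLc, hL', hYc,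
        fun a h => hR'Y a h.1 h.2⟩
      rw [Set.disjoint_left]
      rintro a (rfl | h1) h2
      · have := hinj (j + 1) (by omega) t htM (hR'Y c h2 hcY)
        omega
      · exact hd h1 h2

end Linkage

section Arcs

variable {V : Type*} {G : SimpleGraph V} {f : ℕ → V} {M : ℕ}

theorem ncard_image_of_injOn_le (hinj : ∀ i ≤ M, ∀ j ≤ M, f i = f j → i = j) (A : Finset ℕ)
    (hA : ∀ i ∈ A, i ≤ M) : (f '' (A : Set ℕ)).ncard = A.card := by
  rw [Set.InjOn.ncard_image fun i hi j hj h => hinj i (hA i hi) j (hA j hj) h,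
    Set.ncard_coe_finset]

theorem exists_left_arc (hinj : ∀ i ≤ M, ∀ j ≤ M, f i = f j → i = j)
    (hadj : ∀ i < M, G.Adj (f i) (f (i + 1))) {s u : ℕ} (hsu : s < u) (hu : u ≤ M)
    (h : G.Adj (f 0) (f u)) :
    ∃ A, PathOn G (f s) (f u) (f '' A) ∧ A ⊆ Set.Icc 0 u ∧ 0 ∈ A ∧
      ∀ i ≤ u, G.Adj (f 0) (f i) → i ∈ A := by
  classical
  have hex : ∃ i, s < i ∧ G.Adj (f 0) (f i) := ⟨u, hsu, h⟩
  obtain ⟨h1, h2⟩ := Nat.find_spec hex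
  have hle : Nat.find hex ≤ u := Nat.find_min' hex ⟨hsu, h⟩
  have hmin : ∀ i, s < i → G.Adj (f 0) (f i) → Nat.find hex ≤ i :=
    fun i hi hi' => Nat.find_min' hex ⟨hi, hi'⟩
  generalize Nat.find hex = l at *
  refine ⟨Set.Icc 0 s ∪ Set.Icc l u, ?_, ?_, Or.inl ⟨le_rfl, Nat.zero_le _⟩, ?_⟩
  · rw [Set.image_union]
    refine (PathOn.segment hinj hadj (Nat.zero_le s) (by omega)).symm.link h2
      (PathOn.segment hinj hadj hle hu) ?_
    rw [Set.disjoint_left]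
    rintro a ⟨i, hi, rfl⟩ ⟨j, hj, hij⟩
    have := hinj j (by have := hj.2; omega) i (by have := hi.2; omega) hij
    have := hi.2
    have := hj.1
    omega
  · rintro i (⟨-, hi⟩ | hi)
    · exact ⟨Nat.zero_le _, by omega⟩
    · exact ⟨Nat.zero_le _, hi.2⟩
  · intro i hi hi'
    by_cases his : i ≤ s
    · exact Or.inl ⟨Nat.zero_le _, his⟩
    · exact Or.inr ⟨hmin i (by omega) hi', hi⟩

theorem exists_right_arc (hinj : ∀ i ≤ M, ∀ j ≤ M, f i = f j → i = j)
    (hadj : ∀ i < M, G.Adj (f i) (f (i + 1))) {w t : ℕ} (hwt : w < t) (ht : t ≤ M)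
    (h : G.Adj (f M) (f w)) :
    ∃ A, PathOn G (f w) (f t) (f '' A) ∧ A ⊆ Set.Icc w M ∧ M ∈ A ∧
      ∀ i, w ≤ i → i ≤ M → G.Adj (f M) (f i) → i ∈ A := by
  have hrev : ∀ i ≤ M, M - (M - i) = i := fun i hi => by omega
  obtain ⟨A, p, hA, h0, hN⟩ := exists_left_arc (G := G) (f := fun i => f (M - i)) (M := M)
    (s := M - t) (u := M - w)
    (fun i hi j hj hij => by have := hinj _ (Nat.sub_le M i) _ (Nat.sub_le M j) hij; omega)
    (fun i hi => by
      have := (hadj (M - (i + 1)) (by omega)).symm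
      rwa [show M - (i + 1) + 1 = M - i by omega] at this)
    (by omega) (by omega) (by simpa [hrev w (by omega)] using h)
  simp only [hrev w (by omega), hrev t ht, Nat.sub_zero] at p hN
  refine ⟨(M - ·) '' A, ?_, ?_, ⟨0, h0, by simp⟩, ?_⟩
  · rw [Set.image_image]
    exact p.symm
  · rintro _ ⟨i, hi, rfl⟩
    have := (hA hi).2
    exact ⟨by simp only; omega, Nat.sub_le _ _⟩
  · intro i hwi hi hadj'
    refine ⟨M - i, hN _ (by omega) ?_, hrev i hi⟩
    rwa [hrev i hi]

end Arcs

section Rotation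

variable {V : Type*} [Finite V] {G : SimpleGraph V} {k : ℕ}

open Classical in
theorem NoLongCycle.card_add_card_lt_of_enum (hk : NoLongCycle G k) (hG : Unseparable G)
    {f : ℕ → V} {M : ℕ} (hinj : ∀ i ≤ M, ∀ j ≤ M, f i = f j → i = j)
    (hadj : ∀ i < M, G.Adj (f i) (f (i + 1))) (hM : k ≤ M + 1) (hM1 : 1 ≤ M) :
    ((Finset.range (M + 1)).filter fun i => G.Adj (f 0) (f i)).card +
      ((Finset.range (M + 1)).filter fun i => G.Adj (f M) (f i)).card < k := by
  set N₀ := (Finset.range (M + 1)).filter fun i => G.Adj (f 0) (f i) with hN₀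
  set N₁ := (Finset.range (M + 1)).filter fun i => G.Adj (f M) (f i) with hN₁
  have m₀ : ∀ i, i ∈ N₀ ↔ i ≤ M ∧ G.Adj (f 0) (f i) := fun i => by simp [hN₀]
  have m₁ : ∀ i, i ∈ N₁ ↔ i ≤ M ∧ G.Adj (f M) (f i) := fun i => by simp [hN₁]
  have z₀ : 0 ∉ N₀ := fun h => ((m₀ _).1 h).2.ne rfl
  have z₁ : M ∉ N₁ := fun h => ((m₁ _).1 h).2.ne rfl
  by_cases hcross : ∃ d i, i ∈ N₁ ∧ i + 1 + d ∈ N₀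
  · obtain ⟨i, hi, hj⟩ := Nat.find_spec hcross
    have hmin : ∀ d i, i ∈ N₁ → i + 1 + d ∈ N₀ → Nat.find hcross ≤ d :=
      fun d i h h' => Nat.find_min' hcross ⟨i, h, h'⟩
    generalize Nat.find hcross = d at *
    obtain ⟨hjM, hj⟩ := (m₀ _).1 hj
    obtain ⟨hiM, hi⟩ := (m₁ _).1 hi
    have hcyc := hk _ _ _ ((PathOn.segment hinj hadj (Nat.zero_le i) hiM).link hi.symm
      (PathOn.segment hinj hadj hjM le_rfl).symm (by
        rw [Set.disjoint_left]
        rintro a ⟨x, hx, rfl⟩ ⟨y, hy, hxy⟩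
        have := hinj y hy.2 x (by have := hx.2; omega) hxy
        have := hx.2
        have := hy.1
        omega)) hj
    rw [← Set.image_union, ← Finset.coe_Icc, ← Finset.coe_Icc, ← Finset.coe_union,
      ncard_image_of_injOn_le hinj _ (by
        intro x hx
        rw [Finset.mem_union, Finset.mem_Icc, Finset.mem_Icc] at hx
        omega), Finset.card_union_of_disjoint (by
        rw [Finset.disjoint_left]
        intro x hx hy
        rw [Finset.mem_Icc] at hx hy
        omega), Nat.card_Icc, Nat.card_Icc] at hcyc
    have hd : d ≠ 0 := by omega
    have hcard : N₀.card = (N₀.image (· - 1)).card := by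
      rw [Finset.card_image_of_injOn]
      intro x hx y hy hxy
      have : x ≠ 0 := by rintro rfl; exact z₀ hx
      have : y ≠ 0 := by rintro rfl; exact z₀ hy
      simp only at hxy
      omega
    have hdisj : Disjoint (N₀.image (· - 1)) N₁ := by
      rw [Finset.disjoint_left]
      rintro x hx hx'
      obtain ⟨y, hy, rfl⟩ := Finset.mem_image.1 hx
      have : y ≠ 0 := by rintro rfl; exact z₀ hy
      have := hmin 0 (y - 1) hx' (by rwa [show y - 1 + 1 + 0 = y by omega])
      omega
    have hsub : N₀.image (· - 1) ∪ N₁ ⊆ Finset.Icc 0 i ∪ Finset.Ico (i + d) M := by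
      intro x hx
      rw [Finset.mem_union, Finset.mem_Icc, Finset.mem_Ico]
      rcases Finset.mem_union.1 hx with hx | hx
      · obtain ⟨y, hy, rfl⟩ := Finset.mem_image.1 hx
        have h0 : y ≠ 0 := by rintro rfl; exact z₀ hy
        have hyM := ((m₀ _).1 hy).1
        by_contra hcon
        have := hmin (y - (i + 1)) i ((m₁ _).2 ⟨hiM, hi⟩)
          (by rwa [show i + 1 + (y - (i + 1)) = y by omega])
        omega
      · have h0 : x ≠ M := by rintro rfl; exact z₁ hx
        have hxM := ((m₁ _).1 hx).1
        by_contra hcon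
        have := hmin (i + 1 + d - (x + 1)) x hx (by
          rw [show x + 1 + (i + 1 + d - (x + 1)) = i + 1 + d by omega]
          exact (m₀ _).2 ⟨hjM, hj⟩)
        omega
    have h1 := Finset.card_le_card hsub
    have h2 := Finset.card_union_le (Finset.Icc 0 i) (Finset.Ico (i + d) M)
    rw [Finset.card_union_of_disjoint hdisj, ← hcard] at h1
    rw [Nat.card_Icc, Nat.card_Ico] at h2
    omega
  · have hcross' : ∀ i ∈ N₁, ∀ j ∈ N₀, j ≤ i := fun i hi j hj => by
      by_contra hlt
      exact hcross ⟨j - (i + 1), i, hi, by rwa [show i + 1 + (j - (i + 1)) = j by omega]⟩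
    have h1N : 1 ∈ N₀ := (m₀ 1).2 ⟨hM1, hadj 0 (by omega)⟩
    have hMN : M - 1 ∈ N₁ := (m₁ _).2 ⟨by omega, by
      have := (hadj (M - 1) (by omega)).symm
      rwa [show M - 1 + 1 = M by omega] at this⟩
    obtain ⟨u, hu, humax⟩ := N₀.exists_max_image id ⟨1, h1N⟩
    obtain ⟨w, hw, hwmin⟩ := N₁.exists_min_image id ⟨_, hMN⟩
    simp only [id] at humax hwmin
    have h1u := humax 1 h1N
    have hwM := hwmin _ hMN
    have huw := hcross' w hw u hu
    obtain ⟨huM, hau⟩ := (m₀ _).1 hu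
    obtain ⟨hwM', haw⟩ := (m₁ _).1 hw
    obtain ⟨s, t, b, b', R, R', hs, ht, htM, hb, p, p', hd, hL, hL', hY, hY'⟩ :=
      hG.exists_linkage hinj hadj h1u huw (by omega)
    obtain ⟨A, pA, hA, hA0, hAN⟩ := exists_left_arc hinj hadj hs huM hau
    obtain ⟨B, pB, hB, hBM, hBN⟩ := exists_right_arc hinj hadj ht htM haw
    rw [Set.disjoint_left] at hd
    have pA' : PathOn G (f b') (f b) (f '' A) := by
      rcases hb with ⟨rfl, rfl⟩ | ⟨rfl, rfl⟩
      exacts [pA, pA.symm]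
    have hAL : f '' A ⊆ f '' Set.Icc 0 u := Set.image_mono hA
    have hBY : f '' B ⊆ f '' Set.Icc w M := Set.image_mono hB
    have hAB : ∀ a ∈ f '' A, a ∈ f '' B → a = f u ∧ u = w := by
      rintro a ⟨i, hi, rfl⟩ ⟨j, hj, hij⟩
      have h1 := (hA hi).2
      have h2 := hB hj
      have := hinj j h2.2 i (by omega) hij
      have := h2.1
      obtain rfl : i = u := by omega
      exact ⟨rfl, by omega⟩
    have hABb : ∀ a ∈ f '' A ∪ R, a ∈ f '' B → a = f w := by
      rintro a (h1 | h1) h2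
      · obtain ⟨h3, h4⟩ := hAB a h1 h2
        rw [h3, h4]
      · exact hY ⟨h1, hBY h2⟩
    obtain ⟨x, y, hxy, hadjxy⟩ := PathOn.close
      ((pA'.append p (fun a ha => hL ⟨ha.2, hAL ha.1⟩)).append pB fun a ha => hABb a ha.1 ha.2) p'
      (fun h => by
        have := hinj b' (by omega) t htM h
        omega) (by
        rintro a ⟨(h1 | h1) | h1, h2⟩
        · exact Or.inl (hL' ⟨h2, hAL h1⟩)
        · exact (hd h1 h2).elim
        · exact Or.inr (hY' ⟨h2, hBY h1⟩))
    have hlt := hk _ _ _ hxy hadjxy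
    set D := insert 0 N₀ ∪ insert M (N₁.erase w) with hD
    have hDcard : D.card = N₀.card + N₁.card + 1 := by
      rw [hD, Finset.card_union_of_disjoint, Finset.card_insert_of_notMem z₀,
        Finset.card_insert_of_notMem (by simp [z₁]), Finset.card_erase_of_mem hw]
      · have := Finset.card_pos.2 ⟨w, hw⟩
        omega
      · rw [Finset.disjoint_left]
        intro x hx hx'
        have h1 : x ≤ u := by
          rcases Finset.mem_insert.1 hx with rfl | hx
          exacts [Nat.zero_le _, humax x hx]
        have h2 : w < x := by
          rcases Finset.mem_insert.1 hx' with rfl | hx'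
          · omega
          · obtain ⟨h3, h4⟩ := Finset.mem_erase.1 hx'
            exact lt_of_le_of_ne (hwmin x h4) (Ne.symm h3)
        omega
    have hDM : ∀ i ∈ D, i ≤ M := by
      intro i hi
      rw [hD, Finset.mem_union, Finset.mem_insert, Finset.mem_insert, Finset.mem_erase, m₀, m₁] at hi
      omega
    have hDsub : f '' (D : Set ℕ) ⊆ f '' A ∪ R ∪ f '' B ∪ R' := by
      rintro _ ⟨i, hi, rfl⟩
      rw [Finset.mem_coe, hD, Finset.mem_union, Finset.mem_insert, Finset.mem_insert,
        Finset.mem_erase] at hi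
      rcases hi with (rfl | hi) | (rfl | ⟨-, hi⟩)
      · exact Or.inl (Or.inl (Or.inl ⟨_, hA0, rfl⟩))
      · exact Or.inl (Or.inl (Or.inl ⟨_, hAN i (humax i hi) ((m₀ i).1 hi).2, rfl⟩))
      · exact Or.inl (Or.inr ⟨_, hBM, rfl⟩)
      · exact Or.inl (Or.inr ⟨_, hBN i (hwmin i hi) ((m₁ i).1 hi).1 ((m₁ i).1 hi).2, rfl⟩)
    have := Set.ncard_le_ncard hDsub (Set.toFinite _)
    rw [ncard_image_of_injOn_le hinj _ hDM] at this
    omega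

theorem NoLongCycle.ncard_add_ncard_lt (hk : NoLongCycle G k) (hG : Unseparable G)
    {x y : V} {S : Set V} (p : PathOn G x y S) (hxy : x ≠ y) (hS : k ≤ S.ncard) :
    (G.neighborSet x ∩ S).ncard + (G.neighborSet y ∩ S).ncard < k := by
  classical
  obtain ⟨f, M, rfl, rfl, hM, hinj, hadj, hmem⟩ := p.exists_enum
  have key : ∀ x, (G.neighborSet x ∩ S).ncard ≤
      ((Finset.range (M + 1)).filter fun i => G.Adj x (f i)).card := by
    intro x
    rw [← ncard_image_of_injOn_le hinj _ (by simp; tauto)]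
    refine Set.ncard_le_ncard ?_ (Set.toFinite _)
    rintro a ⟨ha, haS⟩
    obtain ⟨i, hi, rfl⟩ := (hmem a).1 haS
    exact ⟨i, by simpa [Nat.lt_succ_iff] using ⟨hi, ha⟩, rfl⟩
  have h1 : 1 ≤ M := by
    rcases Nat.eq_zero_or_pos M with rfl | h
    · exact (hxy rfl).elim
    · exact h
  have := hk.card_add_card_lt_of_enum hG hinj hadj (by omega) h1
  have := key (f 0)
  have := key (f M)
  omega

end Rotation

section EdgeCount

variable {V : Type*} {G : SimpleGraph V}

/-- The number of edges of `G` with both ends in `W`. -/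
noncomputable def edgesIn (G : SimpleGraph V) (W : Set V) : ℕ :=
  {e ∈ G.edgeSet | ∀ v ∈ e, v ∈ W}.ncard

theorem edgesIn_univ : edgesIn G Set.univ = G.edgeSet.ncard := by
  simp [edgesIn]

theorem edgesIn_empty : edgesIn G ∅ = 0 := by
  have : {e ∈ G.edgeSet | ∀ v ∈ e, v ∈ (∅ : Set V)} = ∅ := by
    refine Set.eq_empty_of_forall_notMem fun e he => ?_
    induction e with
    | _ a b => exact he.2 a (Sym2.mem_mk_left a b)
  rw [edgesIn, this, Set.ncard_empty]

variable [Finite V]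

theorem edgesIn_le_diff_singleton (W : Set V) (v : V) :
    edgesIn G W ≤ edgesIn G (W \ {v}) + (G.neighborSet v ∩ W).ncard := by
  have hsub : {e ∈ G.edgeSet | ∀ v ∈ e, v ∈ W} ⊆ {e ∈ G.edgeSet | ∀ x ∈ e, x ∈ W \ {v}} ∪
      (fun x => s(v, x)) '' (G.neighborSet v ∩ W) := by
    intro e
    induction e with
    | _ a b =>
      simp only [Set.mem_ofPred_eq, mem_edgeSet, Sym2.mem_iff, forall_eq_or_imp, forall_eq,
        Set.mem_union, Set.mem_sdiff, Set.mem_singleton_iff, Set.mem_image, Set.mem_inter_iff,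
        mem_neighborSet]
      rintro ⟨h, ha, hb⟩
      by_cases hav : a = v
      · subst hav
        exact Or.inr ⟨b, ⟨h, hb⟩, rfl⟩
      by_cases hbv : b = v
      · subst hbv
        exact Or.inr ⟨a, ⟨h.symm, ha⟩, Sym2.eq_swap⟩
      · exact Or.inl ⟨h, ⟨ha, hav⟩, hb, hbv⟩
  refine (Set.ncard_le_ncard hsub (Set.toFinite _)).trans ((Set.ncard_union_le _ _).trans ?_)
  exact Nat.add_le_add_left (Set.ncard_image_le (Set.toFinite _)) _

theorem edgesIn_union_le {A B : Set V}
    (h : ∀ x y, G.Adj x y → x ∈ A ∧ y ∈ A ∨ x ∈ B ∧ y ∈ B) :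
    G.edgeSet.ncard ≤ edgesIn G A + edgesIn G B := by
  refine (Set.ncard_le_ncard ?_ (Set.toFinite _)).trans (Set.ncard_union_le _ _)
  intro e
  induction e with
  | _ a b =>
    intro hab
    simpa [G.mem_edgeSet.1 hab] using h a b hab

theorem edgesIn_le_induce (W : Set V) : edgesIn G W ≤ (G.induce W).edgeSet.ncard := by
  have hsub : {e ∈ G.edgeSet | ∀ v ∈ e, v ∈ W} ⊆ Sym2.map Subtype.val '' (G.induce W).edgeSet := by
    intro e
    induction e with
    | _ a b =>
      simp only [Set.mem_ofPred_eq, mem_edgeSet, Sym2.mem_iff, forall_eq_or_imp, forall_eq]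
      rintro ⟨h, ha, hb⟩
      exact ⟨s(⟨a, ha⟩, ⟨b, hb⟩), by simpa using h, rfl⟩
  exact (Set.ncard_le_ncard hsub (Set.toFinite _)).trans (Set.ncard_image_le (Set.toFinite _))

theorem edgesIn_add_le_choose_two {r : ℕ} (hr : G.CliqueFree r) (W : Set V) :
    edgesIn G W + (W.ncard + 1 - r) ≤ W.ncard.choose 2 := by
  induction hn : W.ncard generalizing W with
  | zero =>
    have hr0 : r ≠ 0 := by
      rintro rfl
      exact not_cliqueFree_zero hr
    rw [Set.ncard_eq_zero] at hn
    rw [hn, edgesIn_empty]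
    simp
    omega
  | succ m ih =>
    obtain ⟨x, hx, hdeg⟩ : ∃ x ∈ W, (G.neighborSet x ∩ W).ncard + (if m + 1 < r then 0 else 1) ≤ m := by
      split_ifs with hmr
      · obtain ⟨x, hx⟩ := Set.nonempty_of_ncard_ne_zero (s := W) (by omega)
        refine ⟨x, hx, ?_⟩
        have h1 : G.neighborSet x ∩ W ⊆ W \ {x} := fun y hy => ⟨hy.2, hy.1.ne'⟩
        have h2 := Set.ncard_le_ncard h1 (Set.toFinite _)
        rw [Set.ncard_sdiff_singleton_of_mem hx] at h2
        omega
      · obtain ⟨T, hTW, hT⟩ := Set.exists_subset_card_eq (s := W) (n := r) (by omega)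
        have hTc : ¬ G.IsClique T := fun h => by
          have hf := Set.toFinite T
          refine hr hf.toFinset ⟨by simpa using h, ?_⟩
          rw [← Set.ncard_eq_toFinset_card T hf, hT]
        rw [SimpleGraph.IsClique, Set.Pairwise] at hTc
        push Not at hTc
        obtain ⟨x, hx, y, hy, hxy, hadj⟩ := hTc
        refine ⟨x, hTW hx, ?_⟩
        have h1 : G.neighborSet x ∩ W ⊆ (W \ {x}) \ {y} := fun z hz => ⟨⟨hz.2, hz.1.ne'⟩, by
          rintro rfl
          exact hadj hz.1⟩
        have h2 := Set.ncard_le_ncard h1 (Set.toFinite _)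
        have h3 : y ∈ W \ {x} := ⟨hTW hy, Ne.symm hxy⟩
        have h4 : 0 < (W \ {x}).ncard := (Set.ncard_pos (Set.toFinite _)).2 ⟨y, h3⟩
        rw [Set.ncard_sdiff_singleton_of_mem h3] at h2
        rw [Set.ncard_sdiff_singleton_of_mem (hTW hx)] at h2 h4
        omega
    have h1 := ih (W \ {x}) (by rw [Set.ncard_sdiff_singleton_of_mem hx]; omega)
    have h2 := edgesIn_le_diff_singleton (G := G) W x
    have h3 : (m + 1).choose 2 = m + m.choose 2 := by
      rw [Nat.choose_succ_succ', Nat.choose_one_right]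
    split_ifs at hdeg <;> omega

theorem edgesIn_le_choose_two (W : Set V) : edgesIn G W ≤ W.ncard.choose 2 := by
  have : G.CliqueFree (Nat.card V + 1) := by
    have := Fintype.ofFinite V
    intro s hs
    have := s.card_le_univ
    rw [hs.card_eq, Nat.card_eq_fintype_card] at this
    omega
  exact (Nat.le_add_right _ _).trans (edgesIn_add_le_choose_two this W)

theorem edgesIn_le_of_elimination {d : ℕ} {S : Set V}
    (h : ∀ W, S ⊂ W → ∃ v ∈ W, v ∉ S ∧ (G.neighborSet v ∩ W).ncard ≤ d) (W : Set V) (hW : S ⊆ W) :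
    edgesIn G W ≤ edgesIn G S + d * (W.ncard - S.ncard) := by
  induction hn : W.ncard generalizing W with
  | zero =>
    obtain rfl : W = ∅ := (Set.ncard_eq_zero (Set.toFinite _)).1 hn
    rw [edgesIn_empty]
    exact Nat.zero_le _
  | succ m ih =>
    rcases hW.eq_or_ssubset with rfl | hss
    · exact Nat.le_add_right _ _
    obtain ⟨v, hv, hvS, hdeg⟩ := h W hss
    have hsub : S ⊆ W \ {v} := fun x hx => ⟨hW hx, by rintro rfl; exact hvS hx⟩
    have hcard : (W \ {v}).ncard = m := by rw [Set.ncard_sdiff_singleton_of_mem hv]; omega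
    have h1 := ih _ hsub hcard
    have h2 := edgesIn_le_diff_singleton (G := G) W v
    have h3 := Set.ncard_le_ncard hsub (Set.toFinite _)
    rw [show m + 1 - S.ncard = (m - S.ncard) + 1 by omega, Nat.mul_succ]
    omega

theorem edgesIn_le_of_degenerate {d : ℕ}
    (h : ∀ W : Set V, W.Nonempty → ∃ v ∈ W, (G.neighborSet v ∩ W).ncard ≤ d) (W : Set V)
    (hW : d ≤ W.ncard) : edgesIn G W ≤ d.choose 2 + d * (W.ncard - d) := by
  induction hn : W.ncard generalizing W with
  | zero =>
    obtain rfl : W = ∅ := (Set.ncard_eq_zero (Set.toFinite _)).1 hn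
    rw [edgesIn_empty]
    exact Nat.zero_le _
  | succ m ih =>
    rcases hW.eq_or_lt with rfl | hlt
    · rw [← hn]
      exact (edgesIn_le_choose_two W).trans (Nat.le_add_right _ _)
    obtain ⟨v, hv, hdeg⟩ := h W (Set.nonempty_of_ncard_ne_zero (by omega))
    have hcard : (W \ {v}).ncard = m := by rw [Set.ncard_sdiff_singleton_of_mem hv]; omega
    have h1 := ih (W \ {v}) (by omega) hcard
    have h2 := edgesIn_le_diff_singleton (G := G) W v
    rw [show m + 1 - d = (m - d) + 1 by omega, Nat.mul_succ]
    omega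

end EdgeCount

section Maximal

variable {V : Type*} {G : SimpleGraph V} {k : ℕ}

theorem PathOn.eq_singleton {x : V} {S : Set V} (p : PathOn G x x S) : S = {x} := by
  cases p with
  | single u => rfl
  | cons h hu p => exact (hu p.mem_right).elim

theorem PathOn.of_sup_edge {x y u v : V} {S : Set V} (p : PathOn (G ⊔ edge x y) u v S) :
    PathOn G u v S ∨ ∃ S₁ S₂, S₁ ∪ S₂ = S ∧ Disjoint S₁ S₂ ∧
      (PathOn G u x S₁ ∧ PathOn G y v S₂ ∨ PathOn G u y S₁ ∧ PathOn G x v S₂) := by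
  induction p with
  | single u => exact Or.inl (.single u)
  | @cons u v w S h hu p ih =>
    rw [sup_adj, edge_adj] at h
    rcases ih with ih | ⟨S₁, S₂, rfl, hd, hS⟩
    · rcases h with h | ⟨⟨rfl, rfl⟩ | ⟨rfl, rfl⟩, -⟩
      · exact Or.inl (.cons h hu ih)
      · exact Or.inr ⟨{u}, S, Set.singleton_union, Set.disjoint_singleton_left.2 hu,
          Or.inl ⟨.single u, ih⟩⟩
      · exact Or.inr ⟨{u}, S, Set.singleton_union, Set.disjoint_singleton_left.2 hu,
          Or.inr ⟨.single u, ih⟩⟩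
    · rcases h with h | h
      · have h1 : u ∉ S₁ := fun h => hu (Or.inl h)
        refine Or.inr ⟨insert u S₁, S₂, Set.insert_union, ?_, ?_⟩
        · exact Set.disjoint_insert_left.2 ⟨fun h => hu (Or.inr h), hd⟩
        · rcases hS with ⟨p, q⟩ | ⟨p, q⟩
          exacts [Or.inl ⟨.cons h h1 p, q⟩, Or.inr ⟨.cons h h1 p, q⟩]
      · exfalso
        rcases hS with ⟨p₁, q⟩ | ⟨p₁, q⟩ <;> rcases h with ⟨⟨rfl, rfl⟩ | ⟨rfl, rfl⟩, -⟩
        exacts [hu (Or.inl p₁.mem_right), hu (Or.inr q.mem_left), hu (Or.inr q.mem_left),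
          hu (Or.inl p₁.mem_right)]

theorem exists_pathOn_of_maximal (hG : Maximal (NoLongCycle · k) G) (hk : 3 ≤ k) {x y : V}
    (hxy : x ≠ y) (hadj : ¬ G.Adj x y) : ∃ S, PathOn G x y S ∧ k ≤ S.ncard := by
  have hne : ¬ NoLongCycle (G ⊔ edge x y) k := fun h =>
    hadj (hG.2 h le_sup_left (Or.inr ((edge_adj ..).2 ⟨Or.inl ⟨rfl, rfl⟩, hxy⟩)))
  rw [NoLongCycle] at hne
  push Not at hne
  obtain ⟨u, v, S, p, h, hS⟩ := hne
  rw [sup_adj, edge_adj] at h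
  rcases p.of_sup_edge with p₁ | ⟨S₁, S₂, rfl, hd, hS'⟩
  · rcases h with h | ⟨⟨rfl, rfl⟩ | ⟨rfl, rfl⟩, -⟩
    · exact absurd (hG.1 _ _ _ p₁ h) (by omega)
    · exact ⟨S, p₁, hS⟩
    · exact ⟨S, p₁.symm, hS⟩
  rcases h with h | h
  · refine ⟨S₁ ∪ S₂, ?_, hS⟩
    rcases hS' with ⟨p, q⟩ | ⟨p, q⟩
    · exact p.symm.link h q.symm hd
    · rw [Set.union_comm]
      exact q.link h.symm p hd.symm
  · exfalso
    rw [Set.disjoint_left] at hd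
    have key : S₁ ∪ S₂ = {x, y} := by
      rcases hS' with ⟨p₁, q⟩ | ⟨p₁, q⟩ <;> rcases h with ⟨⟨rfl, rfl⟩ | ⟨rfl, rfl⟩, -⟩
      · rw [p₁.eq_singleton, q.eq_singleton, Set.singleton_union]
      · exact (hd p₁.mem_left q.mem_left).elim
      · exact (hd p₁.mem_right q.mem_right).elim
      · rw [p₁.eq_singleton, q.eq_singleton, Set.union_comm, Set.singleton_union]
    rw [key, Set.ncard_pair hxy] at hS
    omega

variable [Finite V]

theorem NoLongCycle.exists_maximal (hG : NoLongCycle G k) :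
    ∃ H, G ≤ H ∧ Maximal (NoLongCycle · k) H :=
  (Set.toFinite {H : SimpleGraph V | NoLongCycle H k}).exists_le_maximal hG

theorem adj_of_maximal (hmax : Maximal (NoLongCycle · k) G) (hG : Unseparable G) (hk : 3 ≤ k)
    {X Y : Set V} {α β : ℕ} (hX : ∀ x ∈ X, α ≤ (G.neighborSet x ∩ X).ncard)
    (hY : ∀ y ∈ Y, β ≤ (G.neighborSet y ∩ Y).ncard) (hαβ : k ≤ α + β) {x y : V} (hx : x ∈ X)
    (hy : y ∈ Y) (hxy : x ≠ y) : G.Adj x y := by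
  by_contra hadj
  let Q : Set ℕ := {n | ∃ x ∈ X, ∃ y ∈ Y, x ≠ y ∧ ¬ G.Adj x y ∧
    ∃ S, PathOn G x y S ∧ S.ncard = n ∧ k ≤ n}
  have hQb : BddAbove Q := ⟨Nat.card V, by
    rintro n ⟨x, -, y, -, -, -, S, -, rfl, -⟩
    exact Set.ncard_le_card S⟩
  have hQ : Q.Nonempty := by
    obtain ⟨S, p, hS⟩ := exists_pathOn_of_maximal hmax hk hxy hadj
    exact ⟨_, x, hx, y, hy, hxy, hadj, S, p, rfl, hS⟩
  obtain ⟨x, hx, y, hy, hxy, hadj, S, p, hn, hS⟩ := Nat.sSup_mem hQ hQb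
  have hle : ∀ n ∈ Q, n ≤ S.ncard := fun n hn' => hn ▸ le_csSup hQb hn'
  rw [← hn] at hS
  have hxS : G.neighborSet x ∩ X ⊆ G.neighborSet x ∩ S := by
    rintro z ⟨hz, hzX⟩
    refine ⟨hz, ?_⟩
    by_contra hzS
    have q : PathOn G z y (insert z S) := .cons (G.adj_symm hz) hzS p
    have hcard := Set.ncard_insert_of_notMem hzS p.finite
    have hzy : z ≠ y := by rintro rfl; exact hzS p.mem_right
    by_cases h : G.Adj z y
    · exact absurd (hmax.1 _ _ _ q h) (by omega)
    · have := hle _ ⟨z, hzX, y, hy, hzy, h, _, q, rfl, by omega⟩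
      omega
  have hyS : G.neighborSet y ∩ Y ⊆ G.neighborSet y ∩ S := by
    rintro z ⟨hz, hzY⟩
    refine ⟨hz, ?_⟩
    by_contra hzS
    have q : PathOn G x z (insert z S) := p.concat hz hzS
    have hcard := Set.ncard_insert_of_notMem hzS p.finite
    have hxz : x ≠ z := by rintro rfl; exact hzS p.mem_left
    by_cases h : G.Adj x z
    · exact absurd (hmax.1 _ _ _ q h) (by omega)
    · have := hle _ ⟨x, hx, z, hzY, hxz, h, _, q, rfl, by omega⟩
      omega
  have h1 := NoLongCycle.ncard_add_ncard_lt hmax.1 hG p hxy hS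
  have h2 := Set.ncard_le_ncard hxS (Set.toFinite _)
  have h3 := Set.ncard_le_ncard hyS (Set.toFinite _)
  have h4 := hX x hx
  have h5 := hY y hy
  omega

end Maximal

section Core

variable {V : Type*}

/-- The `d`-core: the largest vertex set in which every vertex has more than `d` neighbours. -/
def core (G : SimpleGraph V) (d : ℕ) : Set V :=
  ⋃₀ {S | ∀ v ∈ S, d < (G.neighborSet v ∩ S).ncard}

variable {G : SimpleGraph V} {d : ℕ} {S : Set V}

theorem subset_core (h : ∀ v ∈ S, d < (G.neighborSet v ∩ S).ncard) : S ⊆ core G d :=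
  Set.subset_sUnion_of_mem h

theorem exists_pathOn_of_isClique {T : Set V} (hT : G.IsClique T) (hf : T.Finite)
    (hne : T.Nonempty) : ∃ u v, PathOn G u v T := by
  induction T, hf using Set.Finite.induction_on with
  | empty => exact (Set.not_nonempty_empty hne).elim
  | @insert a T ha hf ih =>
    rcases T.eq_empty_or_nonempty with rfl | hne
    · exact ⟨a, a, by simpa using PathOn.single (G := G) a⟩
    obtain ⟨u, v, p⟩ := ih (hT.subset (Set.subset_insert _ _)) hne
    exact ⟨a, v, .cons (hT (Or.inl rfl) (Or.inr p.mem_left)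
      (by rintro rfl; exact ha p.mem_left)) ha p⟩

theorem NoLongCycle.ncard_lt_of_isClique {k : ℕ} (hG : NoLongCycle G k) (hk : 2 ≤ k) {T : Set V}
    (hT : G.IsClique T) : T.ncard < k := by
  by_contra hlt
  have hf : T.Finite := Set.finite_of_ncard_pos (by omega)
  obtain ⟨u, v, p⟩ := exists_pathOn_of_isClique hT hf (Set.nonempty_of_ncard_ne_zero (by omega))
  refine hlt (hG _ _ _ p (hT p.mem_left p.mem_right ?_))
  rintro rfl
  rw [p.eq_singleton, Set.ncard_singleton] at hlt
  omega

variable [Finite V]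

theorem lt_of_mem_core {v : V} (hv : v ∈ core G d) :
    d < (G.neighborSet v ∩ core G d).ncard := by
  obtain ⟨S, hS, hvS⟩ := hv
  exact (hS v hvS).trans_le
    (Set.ncard_le_ncard (Set.inter_subset_inter_right _ (subset_core hS)) (Set.toFinite _))

theorem exists_le_of_core_ssubset {W : Set V} (hW : core G d ⊂ W) :
    ∃ v ∈ W, v ∉ core G d ∧ (G.neighborSet v ∩ W).ncard ≤ d := by
  by_contra! hcon
  refine hW.2 (subset_core fun v hv => ?_)
  by_cases hvc : v ∈ core G d
  · exact (lt_of_mem_core hvc).trans_le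
      (Set.ncard_le_ncard (Set.inter_subset_inter_right _ hW.1) (Set.toFinite _))
  · exact hcon v hv hvc

theorem Unseparable.two_le_degree (hG : Unseparable G) (hV : 3 ≤ Nat.card V) (v : V) :
    2 ≤ (G.neighborSet v).ncard := by
  have hcard : ∀ T : Set V, T.ncard ≤ 2 → ∃ y, y ∉ T := fun T hT => by
    by_contra! h
    rw [Set.eq_univ_of_forall h, Set.ncard_univ] at hT
    omega
  by_contra hlt
  obtain ⟨c, hcv, hc⟩ : ∃ c, c ≠ v ∧ G.neighborSet v ⊆ {c} := by
    rcases (G.neighborSet v).eq_empty_or_nonempty with h | ⟨c, hc⟩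
    · obtain ⟨c, hc⟩ := hcard {v} (by simp)
      exact ⟨c, hc, by simp [h]⟩
    · refine ⟨c, hc.ne', fun z hz => ?_⟩
      exact (Set.ncard_le_one (Set.toFinite _)).1 (by omega) z hz c hc
  obtain ⟨y, hy⟩ := hcard {v, c} ((Set.ncard_insert_le _ _).trans (by simp))
  obtain ⟨S, p, hcS⟩ := hG c v y hcv.symm (fun h => hy (Or.inr h))
  cases p with
  | single u => exact hy (Or.inl rfl)
  | cons h hu p =>
    obtain rfl := hc h
    exact hcS (Or.inr p.mem_left)

theorem NoLongCycle.edges_le_of_unseparable {a r : ℕ} (hG : NoLongCycle G (2 * a + 2))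
    (hsep : Unseparable G) (hr : G.CliqueFree r) (ha : 1 ≤ a) (hV : 2 * a + 2 ≤ Nat.card V) :
    G.edgeSet.ncard ≤ a.choose 2 + a * (Nat.card V - a) ∨
      ∃ l, a + 2 ≤ l ∧ l ≤ 2 * a ∧
        G.edgeSet.ncard + (l + 1 - r) ≤ l.choose 2 + (2 * a + 2 - l) * (Nat.card V - l) := by
  obtain ⟨H, hGH, hmax⟩ := hG.exists_maximal
  have hH : Unseparable H := fun c x y hx hy =>
    let ⟨S, p, hc⟩ := hsep c x y hx hy
    ⟨S, p.mono hGH, hc⟩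
  have hdeg : ∀ v W, (G.neighborSet v ∩ W).ncard ≤ (H.neighborSet v ∩ W).ncard := fun v W =>
    Set.ncard_le_ncard (Set.inter_subset_inter_left _ fun x hx => hGH hx) (Set.toFinite _)
  rw [← edgesIn_univ, ← Set.ncard_univ]
  rcases (core H a).eq_empty_or_nonempty with hemp | ⟨v₀, hv₀⟩
  · left
    refine edgesIn_le_of_degenerate (fun W hW => ?_) _ (by rw [Set.ncard_univ]; omega)
    have hss : core H a ⊂ W := by
      rw [hemp]
      exact hW.empty_ssubset
    obtain ⟨v, hv, -, h⟩ := exists_le_of_core_ssubset hss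
    exact ⟨v, hv, (hdeg v W).trans h⟩
  right
  set C := core H a with hC
  have hCdeg : ∀ v ∈ C, a + 1 ≤ (H.neighborSet v ∩ C).ncard := fun v hv => lt_of_mem_core hv
  have hclique : H.IsClique C := fun x hx y hy hxy =>
    adj_of_maximal hmax hH (by omega) hCdeg hCdeg (by omega) hx hy hxy
  have hCdeg' : ∀ v ∈ C, (H.neighborSet v ∩ C).ncard = C.ncard - 1 := fun v hv => by
    rw [← Set.ncard_sdiff_singleton_of_mem hv]
    congr 1
    ext z
    exact ⟨fun h => ⟨h.2, h.1.ne'⟩, fun h => ⟨hclique hv h.1 (Ne.symm h.2), h.1⟩⟩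
  have hl : a + 2 ≤ C.ncard := by
    have := hCdeg v₀ hv₀
    have := hCdeg' v₀ hv₀
    omega
  have hsub : core H (2 * a + 2 - C.ncard) ⊆ C := by
    intro x hx
    by_contra hxC
    have hadj : ∀ y ∈ C, H.Adj x y := fun y hy =>
      adj_of_maximal hmax hH (by omega) (fun z hz => Nat.succ_le_of_lt (lt_of_mem_core hz))
        (fun z hz => (hCdeg' z hz).ge) (by omega) hx hy (by rintro rfl; exact hxC hy)
    refine hxC (subset_core (S := insert x C) ?_ (Set.mem_insert x C))
    rintro z (rfl | hz)
    · have h1 : C ⊆ H.neighborSet z ∩ insert z C := fun y hy => ⟨hadj y hy, Or.inr hy⟩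
      have := Set.ncard_le_ncard h1 (Set.toFinite _)
      omega
    · exact (hCdeg z hz).trans (Set.ncard_le_ncard
        (Set.inter_subset_inter_right _ (Set.subset_insert _ _)) (Set.toFinite _))
  have hcore : core H (2 * a + 2 - C.ncard) = C := by
    refine Set.Subset.antisymm hsub (subset_core fun v hv => ?_)
    rw [hCdeg' v hv]
    omega
  refine ⟨C.ncard, hl, ?_, ?_⟩
  · by_contra hlt
    have huniv : Set.univ ⊆ C := hcore ▸ subset_core fun v _ => by
      have := hH.two_le_degree (by omega) v
      rw [Set.inter_univ]
      omega
    have h1 := NoLongCycle.ncard_lt_of_isClique hmax.1 (by omega) hclique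
    have h2 := Set.ncard_le_ncard huniv (Set.toFinite _)
    rw [Set.ncard_univ] at h2
    omega
  · have h1 := edgesIn_add_le_choose_two hr C
    have h2 := edgesIn_le_of_elimination (G := G) (d := 2 * a + 2 - C.ncard) (S := C)
      (fun W hW => by
        obtain ⟨v, hv, hvC, h⟩ := exists_le_of_core_ssubset (G := H)
          (d := 2 * a + 2 - C.ncard) (hcore.symm ▸ hW)
        exact ⟨v, hv, hcore ▸ hvC, (hdeg v W).trans h⟩) _ (Set.subset_univ _)
    omega

end Core

section Arithmetic

theorem two_mul_choose_two (q : ℕ) : 2 * (q + 1).choose 2 = q * (q + 1) := by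
  induction q with
  | zero => rfl
  | succ q ih =>
    rw [Nat.choose_succ_succ', Nat.choose_one_right, mul_add, ih]
    ring

/-- The number of edges of the Turán graph `T(q + 1, c + 1)` when `q ≤ 2 * c + 1`. -/
def blockEdges (c q : ℕ) : ℕ := (q + 1).choose 2 - (q - c)

theorem two_mul_blockEdges (c q : ℕ) : 2 * blockEdges c q + 2 * (q - c) = q * (q + 1) := by
  have h1 := two_mul_choose_two q
  have h2 : q ≤ (q + 1).choose 2 := by nlinarith
  unfold blockEdges
  omega

theorem blockEdges_zero (c : ℕ) : blockEdges c 0 = 0 := by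
  simp [blockEdges]

theorem blockEdges_add_le {c : ℕ} (hc : 1 ≤ c) (x y : ℕ) :
    blockEdges c x + blockEdges c y ≤ blockEdges c (x + y) := by
  have h1 := two_mul_blockEdges c x
  have h2 := two_mul_blockEdges c y
  have h3 := two_mul_blockEdges c (x + y)
  rw [show (x + y) * (x + y + 1) = x * (x + 1) + y * (y + 1) + 2 * (x * y) by ring] at h3
  rcases Nat.eq_zero_or_pos x with rfl | hx
  · simp [blockEdges_zero]
  rcases Nat.eq_zero_or_pos y with rfl | hy
  · simp [blockEdges_zero]
  have : x + y ≤ x * y + 1 := by nlinarith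
  omega

theorem blockEdges_add_le_of_wrap {a c : ℕ} (hc : c + 1 ≤ 2 * a) {x y t : ℕ} (hx : x ≤ 2 * a)
    (hy : y ≤ 2 * a) (ht : x + y = 2 * a + t) :
    blockEdges c x + blockEdges c y ≤ blockEdges c (2 * a) + blockEdges c t := by
  obtain ⟨u, hu⟩ := Nat.exists_eq_add_of_le hx
  obtain ⟨v, hv⟩ := Nat.exists_eq_add_of_le hy
  have h1 := two_mul_blockEdges c x
  have h2 := two_mul_blockEdges c y
  have h3 := two_mul_blockEdges c (2 * a)
  have h4 := two_mul_blockEdges c t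
  have key : 2 * a * (2 * a + 1) + t * (t + 1) = x * (x + 1) + y * (y + 1) + 2 * (u * v) := by
    zify at *
    rw [show (u : ℤ) = 2 * a - x by linarith, show (v : ℤ) = 2 * a - y by linarith,
      show (t : ℤ) = x + y - 2 * a by linarith]
    ring
  rcases Nat.eq_zero_or_pos u with rfl | hu'
  · obtain rfl : y = t := by omega
    rw [hu, add_zero]
  rcases Nat.eq_zero_or_pos v with rfl | hv'
  · obtain rfl : x = t := by omega
    rw [hv, add_zero, add_comm]
  have k1 : u ≤ u * v := Nat.le_mul_of_pos_right u hv'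
  have k2 : v ≤ u * v := Nat.le_mul_of_pos_left v hu'
  have k3 : u + v ≤ u * v + 1 := by nlinarith
  omega

/-- The number of edges of a graph with `x + 1` vertices made of as many blocks
`T(2 * a + 1, c + 1)` as possible and one smaller block, all sharing a vertex. -/
def windmillEdges (a c x : ℕ) : ℕ :=
  x / (2 * a) * blockEdges c (2 * a) + blockEdges c (x % (2 * a))

theorem windmillEdges_eq {a c : ℕ} (p : ℕ) {q : ℕ} (hq : q < 2 * a) :
    windmillEdges a c (p * (2 * a) + q) = p * blockEdges c (2 * a) + blockEdges c q := by
  rw [windmillEdges, Nat.add_comm (p * (2 * a)), Nat.add_mul_div_right _ _ (by omega),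
    Nat.add_mul_mod_self_right, Nat.div_eq_of_lt hq, Nat.mod_eq_of_lt hq, zero_add]

theorem windmillEdges_of_le {a c : ℕ} (ha : 1 ≤ a) {x : ℕ} (hx : x ≤ 2 * a) :
    windmillEdges a c x = blockEdges c x := by
  rcases hx.eq_or_lt with rfl | hlt
  · simpa [blockEdges_zero] using windmillEdges_eq (a := a) (c := c) 1 (q := 0) (by omega)
  · simpa using windmillEdges_eq (a := a) (c := c) 0 hlt

theorem exists_windmill_decomposition {a : ℕ} (ha : 1 ≤ a) (x : ℕ) :
    ∃ p q, q < 2 * a ∧ x = p * (2 * a) + q :=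
  ⟨x / (2 * a), x % (2 * a), Nat.mod_lt _ (by omega), by rw [mul_comm, Nat.div_add_mod]⟩

theorem windmillEdges_add_le {a c : ℕ} (ha : 1 ≤ a) (hc : 1 ≤ c) (hca : c + 1 ≤ 2 * a) (x y : ℕ) :
    windmillEdges a c x + windmillEdges a c y ≤ windmillEdges a c (x + y) := by
  obtain ⟨p₁, q₁, h₁, rfl⟩ := exists_windmill_decomposition ha x
  obtain ⟨p₂, q₂, h₂, rfl⟩ := exists_windmill_decomposition ha y
  rw [windmillEdges_eq p₁ h₁, windmillEdges_eq p₂ h₂]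
  by_cases h : q₁ + q₂ < 2 * a
  · rw [show p₁ * (2 * a) + q₁ + (p₂ * (2 * a) + q₂) = (p₁ + p₂) * (2 * a) + (q₁ + q₂) by ring,
      windmillEdges_eq _ h]
    have := blockEdges_add_le hc q₁ q₂
    linarith
  · obtain ⟨t, ht⟩ := Nat.exists_eq_add_of_le (not_lt.1 h)
    rw [show p₁ * (2 * a) + q₁ + (p₂ * (2 * a) + q₂) = (p₁ + p₂ + 1) * (2 * a) + t by linarith,
      windmillEdges_eq _ (by omega)]
    have := blockEdges_add_le_of_wrap hca h₁.le h₂.le ht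
    linarith

theorem two_mul_sub_le_mul {b c q : ℕ} (hbc : b ≤ c) :
    2 * ((q - c : ℕ) : ℤ) ≤ ((q : ℤ) - b) * (q - b + 1) := by
  rcases le_total q c with h | h
  · rw [Nat.sub_eq_zero_of_le h]
    rcases lt_or_ge q b with h' | h'
    · have h1 : ((q : ℤ) - b) ≤ -1 := by omega
      simp only [Nat.cast_zero, mul_zero]
      exact mul_nonneg_of_nonpos_of_nonpos (by linarith) (by linarith)
    · have h1 : 0 ≤ ((q : ℤ) - b) := by omega
      simp only [Nat.cast_zero, mul_zero]
      exact mul_nonneg h1 (by linarith)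
  · rw [Nat.cast_sub h]
    rcases h.eq_or_lt with rfl | h
    · have h1 : 0 ≤ ((c : ℤ) - b) := by omega
      rw [sub_self, mul_zero]
      exact mul_nonneg h1 (by linarith)
    · have h1 : 1 ≤ ((q : ℤ) - b) := by omega
      have h2 : (q : ℤ) - c ≤ q - b := by omega
      nlinarith

theorem choose_add_mul_le_windmillEdges {a c n : ℕ} (ha : 1 ≤ a) (hac : a ≤ c)
    (hca : c + 1 ≤ 2 * a) (hn : 2 * a + 2 ≤ n) :
    a.choose 2 + a * (n - a) ≤ windmillEdges a c (n - 1) := by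
  obtain ⟨p, q, hq, h⟩ := exists_windmill_decomposition ha (n - 1)
  rw [h, windmillEdges_eq p hq, show n - a = p * (2 * a) + q + 1 - a by omega]
  obtain ⟨a, rfl⟩ : ∃ a', a = a' + 1 := ⟨a - 1, by omega⟩
  have h1 := two_mul_choose_two a
  have h2 := two_mul_blockEdges c q
  have h3 := two_mul_blockEdges c (2 * (a + 1))
  have h4 := two_mul_sub_le_mul (q := q) hac
  have h5 : a + 1 ≤ p * (2 * (a + 1)) + q + 1 := by omega
  have h6 : c ≤ 2 * (a + 1) := by omega
  zify [h5, h6] at *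
  have h7 : (0 : ℤ) ≤ p * (c - (a + 1)) := mul_nonneg (by positivity) (by linarith)
  nlinarith

theorem choose_add_mul_le_windmillEdges_add {a c l n : ℕ} (ha : 1 ≤ a) (hac : a ≤ c)
    (hca : c + 1 ≤ 2 * a) (hn : 2 * a + 2 ≤ n) (hl : a + 2 ≤ l) (hl' : l ≤ 2 * a) :
    l.choose 2 + (2 * a + 2 - l) * (n - l) ≤ windmillEdges a c (n - 1) + (l - 1 - c) := by
  obtain ⟨p, q, hq, h⟩ := exists_windmill_decomposition ha (n - 1)
  have hp : p ≠ 0 := by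
    rintro rfl
    omega
  obtain ⟨p, rfl⟩ := Nat.exists_eq_succ_of_ne_zero hp
  obtain ⟨b, hb⟩ := Nat.exists_eq_add_of_le (show l ≤ 2 * a + 2 by omega)
  obtain ⟨m, rfl⟩ : ∃ m, l = m + 1 := ⟨l - 1, by omega⟩
  have e1 : n - (m + 1) = p * (2 * a) + q + b - 1 := by
    rw [Nat.succ_mul] at h
    omega
  rw [h, windmillEdges_eq _ hq, e1, show 2 * a + 2 - (m + 1) = b by omega]
  have h1 := two_mul_choose_two m
  have h2 := two_mul_blockEdges c q
  have h3 := two_mul_blockEdges c (2 * a)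
  have h4 := two_mul_sub_le_mul (b := b) (q := q) (c := c) (by omega)
  have h5 : 1 ≤ p * (2 * a) + q + b := by omega
  have h6 : c ≤ 2 * a := by omega
  have h7 : (m : ℤ) - c ≤ ((m + 1 - 1 - c : ℕ) : ℤ) := by omega
  have hba : b ≤ a := by omega
  have hb2 : 2 ≤ b := by omega
  clear hp h e1
  generalize m + 1 - 1 - c = e at *
  zify [h5, h6] at *
  rw [show (m : ℤ) = 2 * a + 1 - b by linarith] at h1 h7
  have h8 : (0 : ℤ) ≤ p * (2 * a * (a - b) + (c - a)) :=
    mul_nonneg (by positivity) (add_nonneg (mul_nonneg (by positivity) (by linarith)) (by linarith))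
  have h9 : (0 : ℤ) ≤ (a - b) * (b - 1) := mul_nonneg (by linarith) (by linarith)
  have h10 := congrArg (HMul.hMul (p : ℤ)) h3
  linarith

end Arithmetic

section UpperBound

universe u

theorem NoLongCycle.induce {V : Type u} {G : SimpleGraph V} {k : ℕ} (hG : NoLongCycle G k)
    (W : Set V) : NoLongCycle (G.induce W) k := by
  intro u v S p h
  have := hG _ _ _ (p.of_embedding (Embedding.induce W)) h
  rwa [Set.ncard_image_of_injective _ (Embedding.induce W).injective] at this

theorem exists_separation_of_not_unseparable {V : Type u} {G : SimpleGraph V}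
    (h : ¬ Unseparable G) :
    ∃ (c x y : V) (A : Set V), x ≠ c ∧ y ≠ c ∧ c ∉ A ∧ x ∈ A ∧ y ∉ A ∧
      ∀ z w, z ∈ A → w ≠ c → G.Adj z w → w ∈ A := by
  rw [Unseparable] at h
  push Not at h
  obtain ⟨c, x, y, hx, hy, h⟩ := h
  refine ⟨c, x, y, {z | ∃ S, PathOn G x z S ∧ c ∉ S}, hx, hy, ?_, ?_, ?_, ?_⟩
  · rintro ⟨S, p, hc⟩
    exact hc p.mem_right
  · exact ⟨{x}, .single x, fun h => hx h.symm⟩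
  · rintro ⟨S, p, hc⟩
    exact hc (h S p)
  · rintro z w ⟨S, p, hc⟩ hw hzw
    by_cases hwS : w ∈ S
    · obtain ⟨S₁, S₂, p₁, -, rfl, -⟩ := p.split hwS
      exact ⟨S₁, p₁, fun h => hc (Or.inl h)⟩
    · refine ⟨_, p.concat hzw hwS, ?_⟩
      rintro (rfl | h)
      exacts [hw rfl, hc h]

theorem NoLongCycle.edges_le {a r : ℕ} (ha : 2 ≤ a) (har : a + 2 ≤ r) (hra : r ≤ 2 * a + 1) (n : ℕ) :
    ∀ {V : Type u} [Finite V] {G : SimpleGraph V}, Nat.card V = n + 1 →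
      NoLongCycle G (2 * a + 2) → G.CliqueFree r →
        G.edgeSet.ncard ≤ windmillEdges a (r - 2) n := by
  induction n using Nat.strong_induction_on with
  | _ n ih =>
  intro V _ G hV hG hr
  by_cases hn : n ≤ 2 * a
  · rw [windmillEdges_of_le (by omega) hn, ← edgesIn_univ, blockEdges]
    have := edgesIn_add_le_choose_two hr Set.univ
    rw [Set.ncard_univ, hV] at this
    omega
  by_cases hsep : Unseparable G
  · rcases hG.edges_le_of_unseparable hsep hr (by omega) (by omega) with h | ⟨l, h1, h2, h⟩
    · refine h.trans ?_
      rw [hV]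
      exact choose_add_mul_le_windmillEdges (n := n + 1) (by omega) (by omega) (by omega) (by omega)
    · have := choose_add_mul_le_windmillEdges_add (a := a) (c := r - 2) (n := n + 1) (by omega)
        (by omega) (by omega) (by omega) h1 h2
      rw [hV] at h
      simp only [Nat.add_sub_cancel] at this
      omega
  · obtain ⟨c, x, y, A, hx, hy, hcA, hxA, hyA, hA⟩ := exists_separation_of_not_unseparable hsep
    set B := (insert c A)ᶜ with hB
    have hcB : c ∉ B := fun h => h (Or.inl rfl)
    have hcov := edgesIn_union_le (G := G) (A := insert c A) (B := insert c B) (by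
      intro z w hzw
      by_cases hz : z = c
      · subst hz
        by_cases hw : w ∈ A
        · exact Or.inl ⟨Or.inl rfl, Or.inr hw⟩
        · exact Or.inr ⟨Or.inl rfl, Or.inr fun h => h.elim hzw.ne' hw⟩
      by_cases hw : w = c
      · subst hw
        by_cases hz : z ∈ A
        · exact Or.inl ⟨Or.inr hz, Or.inl rfl⟩
        · exact Or.inr ⟨Or.inr fun h => h.elim hzw.ne hz, Or.inl rfl⟩
      by_cases hzA : z ∈ A
      · exact Or.inl ⟨Or.inr hzA, Or.inr (hA z w hzA hw hzw)⟩
      · have hwA : w ∉ A := fun h => hzA (hA w z h hz hzw.symm)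
        exact Or.inr ⟨Or.inr fun h => h.elim hz hzA, Or.inr fun h => h.elim hw hwA⟩)
    have hcard := Set.ncard_add_ncard_compl (insert c A)
    rw [← hB, hV, Set.ncard_insert_of_notMem hcA] at hcard
    have hApos : 0 < A.ncard := (Set.ncard_pos (Set.toFinite _)).2 ⟨x, hxA⟩
    have hBpos : 0 < B.ncard := (Set.ncard_pos (Set.toFinite _)).2 ⟨y, fun h => h.elim hy hyA⟩
    have key : ∀ W : Set V, c ∉ W → W.ncard < n →
        edgesIn G (insert c W) ≤ windmillEdges a (r - 2) W.ncard := fun W hcW hW =>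
      (edgesIn_le_induce _).trans (ih _ hW
        (by rw [Nat.card_coe_set_eq, Set.ncard_insert_of_notMem hcW]) (hG.induce _)
        (hr.comap ⟨(Embedding.induce _).toCopy⟩))
    have h1 := key A hcA (by omega)
    have h2 := key B hcB (by omega)
    have h3 := windmillEdges_add_le (a := a) (c := r - 2) (by omega) (by omega) (by omega)
      A.ncard B.ncard
    rw [show A.ncard + B.ncard = n by omega] at h3
    omega

end UpperBound

section Turan

theorem noLongCycle_of_isCycle {V : Type*} {G : SimpleGraph V} {k : ℕ} (hk : 3 ≤ k)
    (hG : ∀ (v : V) (C : G.Walk v v), C.IsCycle → C.length < k) : NoLongCycle G k := by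
  intro u v S p h
  by_contra! hS
  obtain ⟨q, hq, -, hl⟩ := p.exists_walk
  have hC : (Walk.cons h.symm q).IsCycle := by
    rw [Walk.cons_isCycle_iff]
    refine ⟨hq, fun he => ?_⟩
    have h1 := hq.length_eq_one_of_mem_edges (by rwa [Sym2.eq_swap])
    omega
  have := hG _ _ hC
  rw [Walk.length_cons] at this
  omega

theorem bddAbove_cliqueFree_edges (n r : ℕ) :
    BddAbove {m | ∃ G : SimpleGraph (Fin n), G.CliqueFree r ∧ G.edgeSet.ncard = m} := by
  refine ⟨Nat.card (Sym2 (Fin n)), ?_⟩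
  rintro _ ⟨G, -, rfl⟩
  exact Set.ncard_le_card _

theorem exists_edges_eq_exK (n : ℕ) {r : ℕ} (hr : 2 ≤ r) :
    ∃ G : SimpleGraph (Fin n), G.CliqueFree r ∧ G.edgeSet.ncard = exK n r :=
  Nat.sSup_mem (s := {m | ∃ G : SimpleGraph (Fin n), G.CliqueFree r ∧ G.edgeSet.ncard = m})
    ⟨_, ⊥, cliqueFree_bot hr, rfl⟩ (bddAbove_cliqueFree_edges n r)

theorem blockEdges_le_exK {r q : ℕ} (hr : 2 ≤ r) (hq : q + 1 ≤ 2 * (r - 1)) :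
    blockEdges (r - 2) q ≤ exK (q + 1) r := by
  obtain ⟨r, rfl⟩ := Nat.exists_eq_add_of_le' hr
  refine le_trans ?_ (le_csSup (bddAbove_cliqueFree_edges _ _)
    ⟨turanGraph (q + 1) (r + 1), turanGraph_cliqueFree (by omega), rfl⟩)
  have htop : ∀ m ≤ r + 1, (turanGraph m (r + 1)).edgeFinset.card = m.choose 2 := by
    intro m hm
    have h1 : turanGraph m (r + 1) = ⊤ := turanGraph_eq_top.2 (Or.inr hm)
    have h2 := card_edgeFinset_top_eq_card_choose_two (V := Fin m)
    rw [Fintype.card_fin] at h2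
    rw [← h2, ← Set.ncard_coe_finset, ← Set.ncard_coe_finset, coe_edgeFinset, coe_edgeFinset, h1]
  rw [← coe_edgeFinset, Set.ncard_coe_finset, blockEdges]
  rcases Nat.le_total (q + 1) (r + 1) with h | h
  · rw [htop _ h]
    exact Nat.sub_le _ _
  · obtain ⟨m, hm⟩ := Nat.exists_eq_add_of_le' h
    rw [hm, card_edgeFinset_turanGraph_add, htop m (by omega), Nat.add_sub_cancel]
    have h2 : (m + (r + 1)).choose 2 = m.choose 2 + m * (r + 1) + (r + 1).choose 2 := by
      rw [Nat.add_choose_eq, Finset.Nat.sum_antidiagonal_eq_sum_range_succ_mk]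
      simp [Finset.sum_range_succ]
      ring
    rw [h2, mul_add, Nat.add_sub_cancel]
    omega

end Turan

section Gluing

variable {V : Type*} {G H : SimpleGraph V} {A B : Set V} {c : V}

theorem SimpleGraph.Adj.notMem_or_notMem {x y : V} (h : H.Adj x y) (hH : H.support ⊆ B)
    (hAB : A ∩ B = {c}) : x ∉ A ∨ y ∉ A := by
  by_contra! hxy
  have hx : x ∈ A ∩ B := ⟨hxy.1, hH ⟨y, h⟩⟩
  have hy : y ∈ A ∩ B := ⟨hxy.2, hH ⟨x, h.symm⟩⟩
  rw [hAB] at hx hy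
  exact h.ne (hx.trans hy.symm)

theorem SimpleGraph.Walk.mem_support_of_inter_eq (hG : G.support ⊆ A) (hH : H.support ⊆ B)
    (hAB : A ∩ B = {c}) {u w : V} (p : (G ⊔ H).Walk u w) (hu : u ∈ A) (hw : w ∈ B) :
    c ∈ p.support := by
  induction p with
  | nil =>
    have : _ ∈ A ∩ B := ⟨hu, hw⟩
    rw [hAB] at this
    exact this ▸ Walk.start_mem_support _
  | @cons u v w h p ih =>
    rcases h with h | h
    · exact List.mem_cons_of_mem _ (ih (hG ⟨u, h.symm⟩) hw)
    · have : u ∈ A ∩ B := ⟨hu, hH ⟨v, h⟩⟩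
      rw [hAB] at this
      exact this ▸ Walk.start_mem_support _

theorem isCycle_length_lt_of_sup {k : ℕ} (hG : G.support ⊆ A) (hH : H.support ⊆ B)
    (hAB : A ∩ B = {c}) (hGk : ∀ (v : V) (C : G.Walk v v), C.IsCycle → C.length < k)
    (hHk : ∀ (v : V) (C : H.Walk v v), C.IsCycle → C.length < k)
    (v : V) (C : (G ⊔ H).Walk v v) (hC : C.IsCycle) : C.length < k := by
  classical
  have hBA : B ∩ A = {c} := by rw [Set.inter_comm, hAB]
  by_cases h1 : ∀ e ∈ C.edges, e ∈ G.edgeSet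
  · simpa using hGk v _ (hC.transfer h1)
  by_cases h2 : ∀ e ∈ C.edges, e ∈ H.edgeSet
  · simpa using hHk v _ (hC.transfer h2)
  exfalso
  obtain ⟨w, hwC, hwB, hwA⟩ : ∃ w ∈ C.support, w ∈ B ∧ w ∉ A := by
    push Not at h1
    obtain ⟨⟨x, y⟩, he, h⟩ := h1
    have hxy : H.Adj x y := (C.adj_of_mem_edges he).resolve_left h
    rcases hxy.notMem_or_notMem hH hAB with hx | hy
    · exact ⟨x, C.fst_mem_support_of_mem_edges he, hH ⟨y, hxy⟩, hx⟩
    · exact ⟨y, C.snd_mem_support_of_mem_edges he, hH ⟨x, hxy.symm⟩, hy⟩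
  obtain ⟨u, huC, huA, huB⟩ : ∃ u ∈ C.support, u ∈ A ∧ u ∉ B := by
    push Not at h2
    obtain ⟨⟨x, y⟩, he, h⟩ := h2
    have hxy : G.Adj x y := (C.adj_of_mem_edges he).resolve_right h
    rcases hxy.notMem_or_notMem hG hBA with hx | hy
    · exact ⟨x, C.fst_mem_support_of_mem_edges he, hG ⟨y, hxy⟩, hx⟩
    · exact ⟨y, C.snd_mem_support_of_mem_edges he, hG ⟨x, hxy.symm⟩, hy⟩
  have hc : c ∈ A ∩ B := hAB ▸ rfl
  have hD := hC.rotate huC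
  have hw : w ∈ (C.rotate u huC).support := (Walk.mem_support_rotate_iff ..).2 hwC
  generalize C.rotate u huC = D at hD hw
  have k1 := (D.takeUntil w hw).mem_support_of_inter_eq hG hH hAB huA hwB
  have k2 := (D.dropUntil w hw).reverse.mem_support_of_inter_eq hG hH hAB huA hwB
  rw [Walk.support_reverse, List.mem_reverse] at k2
  have k3 := hD.support_nodup
  rw [← D.take_spec hw, Walk.tail_support_append] at k3
  refine List.disjoint_of_nodup_append k3 (a := c) ?_ ?_
  · exact ((Walk.mem_support_iff _).1 k1).resolve_left fun h => huB (h ▸ hc.2)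
  · exact ((Walk.mem_support_iff _).1 k2).resolve_left fun h => hwA (h ▸ hc.1)

theorem SimpleGraph.CliqueFree.sup_of_inter_eq {r : ℕ} (hGr : G.CliqueFree r) (hHr : H.CliqueFree r)
    (hG : G.support ⊆ A) (hH : H.support ⊆ B) (hAB : A ∩ B = {c}) : (G ⊔ H).CliqueFree r := by
  have hBA : B ∩ A = {c} := by rw [Set.inter_comm, hAB]
  intro s hs
  obtain ⟨w, hws, hwA⟩ : ∃ w ∈ s, w ∉ A := by
    by_contra! hA
    refine hGr s ⟨fun x hx y hy hxy => ?_, hs.2⟩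
    refine (hs.1 hx hy hxy).resolve_right fun h => ?_
    exact (h.notMem_or_notMem hH hAB).elim (· (hA x hx)) (· (hA y hy))
  obtain ⟨u, hus, huB⟩ : ∃ u ∈ s, u ∉ B := by
    by_contra! hB
    refine hHr s ⟨fun x hx y hy hxy => ?_, hs.2⟩
    refine (hs.1 hx hy hxy).resolve_left fun h => ?_
    exact (h.notMem_or_notMem hG hBA).elim (· (hB x hx)) (· (hB y hy))
  by_cases huw : u = w
  · subst huw
    refine hGr s ⟨fun x hx y hy hxy => ?_, hs.2⟩
    obtain ⟨z, hz⟩ : ∃ z, (G ⊔ H).Adj u z := by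
      by_cases hxu : x = u
      · exact ⟨y, hxu ▸ hs.1 hx hy hxy⟩
      · exact ⟨x, hs.1 hus hx (Ne.symm hxu)⟩
    exact (hz.elim (fun h => hwA (hG ⟨z, h⟩)) (fun h => huB (hH ⟨z, h⟩))).elim
  rcases hs.1 hus hws huw with h | h
  · exact hwA (hG ⟨u, h.symm⟩)
  · exact huB (hH ⟨w, h⟩)

theorem ncard_edgeSet_sup [Finite V] (hG : G.support ⊆ A) (hH : H.support ⊆ B)
    (hAB : A ∩ B = {c}) : (G ⊔ H).edgeSet.ncard = G.edgeSet.ncard + H.edgeSet.ncard := by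
  rw [edgeSet_sup, Set.ncard_union_eq _ (Set.toFinite _) (Set.toFinite _)]
  rw [Set.disjoint_left]
  rintro ⟨x, y⟩ h1 h2
  have h1 : G.Adj x y := h1
  exact (SimpleGraph.Adj.notMem_or_notMem h2 hH hAB).elim (· (hG ⟨y, h1⟩)) (· (hG ⟨x, h1.symm⟩))

theorem isCycle_length_lt_of_support_subset [Finite V] {k : ℕ} (hG : G.support ⊆ A)
    (hA : A.ncard < k) (v : V) (C : G.Walk v v) (hC : C.IsCycle) : C.length < k := by
  classical
  have h1 : C.support.tail.length = C.length := by simp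
  rw [← h1, ← List.toFinset_card_of_nodup hC.support_nodup, ← Set.ncard_coe_finset]
  refine (Set.ncard_le_ncard (fun x hx => hG ?_)).trans_lt hA
  exact mem_support_of_mem_walk_support C hC.not_nil
    (List.mem_of_mem_tail (List.mem_toFinset.1 hx))

end Gluing

section Windmill

theorem exists_block {n m s r : ℕ} (hr : 2 ≤ r) (hm : 1 ≤ m) (hs : s + m ≤ n) :
    ∃ G : SimpleGraph (Fin n), G.support ⊆ {i | s ≤ i.val ∧ i.val < s + m} ∧ G.CliqueFree r ∧
      G.edgeSet.ncard = exK m r := by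
  obtain ⟨G, hG, he⟩ := exists_edges_eq_exK m hr
  let f : Fin m ↪ Fin n := ⟨fun i => ⟨s + i, by omega⟩, fun i j h => by simpa [Fin.ext_iff] using h⟩
  have : Nonempty (Fin m) := ⟨⟨0, hm⟩⟩
  refine ⟨G.map f, ?_, cliqueFree_map_iff.2 hG, ?_⟩
  · rintro _ ⟨_, -, x, y, -, rfl, -⟩
    exact ⟨Nat.le_add_right _ _, Nat.add_lt_add_left x.isLt _⟩
  · rw [edgeSet_map, Set.ncard_image_of_injective _ f.sym2Map.injective, he]

theorem ncard_setOf_val_lt {n s m : ℕ} : {i : Fin n | s ≤ i.val ∧ i.val < s + m}.ncard ≤ m := by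
  rw [← Set.ncard_image_of_injective _ Fin.val_injective]
  refine (Set.ncard_le_ncard (t := ↑(Finset.Ico s (s + m))) ?_ (Finset.finite_toSet _)).trans ?_
  · rintro _ ⟨i, hi, rfl⟩
    exact Finset.mem_coe.2 (Finset.mem_Ico.2 hi)
  · rw [Set.ncard_coe_finset, Nat.card_Ico, Nat.add_sub_cancel_left]

theorem exists_windmill {n k r q : ℕ} (hr : 2 ≤ r) (hk : 3 ≤ k) (hq : q ≤ k - 3) (p : ℕ)
    (hn : p * (k - 2) + q < n) :
    ∃ G : SimpleGraph (Fin n), G.support ⊆ {i | i.val ≤ p * (k - 2) + q} ∧ G.CliqueFree r ∧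
      (∀ (v : Fin n) (C : G.Walk v v), C.IsCycle → C.length < k) ∧
      G.edgeSet.ncard = p * exK (k - 1) r + exK (q + 1) r := by
  induction p with
  | zero =>
    obtain ⟨G, h1, h2, h3⟩ := exists_block (n := n) (m := q + 1) (s := 0) hr (by omega) (by omega)
    refine ⟨G, fun i hi => ?_, h2, isCycle_length_lt_of_support_subset h1 ?_, by simp [h3]⟩
    · have := h1 hi
      simp only [Set.mem_ofPred_eq] at this ⊢
      omega
    · exact ncard_setOf_val_lt.trans_lt (by omega)
  | succ p ih =>
    rw [Nat.succ_mul] at hn ⊢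
    obtain ⟨G, h1, h2, h3, h4⟩ := ih (by omega)
    obtain ⟨H, k1, k2, k3⟩ := exists_block (n := n) (m := k - 1) (s := p * (k - 2) + q) hr
      (by omega) (by omega)
    have hAB : {i : Fin n | i.val ≤ p * (k - 2) + q} ∩
        {i | p * (k - 2) + q ≤ i.val ∧ i.val < p * (k - 2) + q + (k - 1)} =
        {⟨p * (k - 2) + q, by omega⟩} := by
      ext i
      simp only [Set.mem_inter_iff, Set.mem_ofPred_eq, Set.mem_singleton_iff, Fin.ext_iff]
      omega
    refine ⟨G ⊔ H, ?_, h2.sup_of_inter_eq k2 h1 k1 hAB, isCycle_length_lt_of_sup h1 k1 hAB h3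
      (isCycle_length_lt_of_support_subset k1 (ncard_setOf_val_lt.trans_lt (by omega))), ?_⟩
    · rintro i ⟨j, hj | hj⟩
      · have := h1 ⟨j, hj⟩
        simp only [Set.mem_ofPred_eq] at this ⊢
        omega
      · have := k1 ⟨j, hj⟩
        simp only [Set.mem_ofPred_eq] at this ⊢
        omega
    · rw [ncard_edgeSet_sup h1 k1 hAB, h4, k3]
      ring

end Windmill

theorem stmt_17 (n k r p q : ℕ) (hke : Even k) (hk : 6 ≤ k)
    (hr1 : (k - 1) / 2 + 2 ≤ r) (hr2 : r < k) (hkn : k ≤ n)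
    (hd : n - 1 = p * (k - 2) + q) (hq : q ≤ k - 3) :
    IsGreatest {m | ∃ G : SimpleGraph (Fin n), G.CliqueFree r ∧
        (∀ (v : Fin n) (C : G.Walk v v), C.IsCycle → C.length < k) ∧
        G.edgeSet.ncard = m}
      (p * exK (k - 1) r + exK (q + 1) r) := by
  constructor
  · obtain ⟨G, -, h1, h2, h3⟩ := exists_windmill (n := n) (k := k) (r := r) (by omega)
      (by omega) hq p (by omega)
    exact ⟨G, h1, h2, h3⟩
  · rintro _ ⟨G, h1, h2, rfl⟩
    obtain ⟨a, ha⟩ : ∃ a, k = 2 * a + 2 := by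
      obtain ⟨b, rfl⟩ := hke
      exact ⟨b - 1, by omega⟩
    subst ha
    refine ((noLongCycle_of_isCycle (by omega) h2).edges_le (a := a) (n := n - 1) (by omega)
      (by omega) (by omega) (by rw [Nat.card_fin]; omega) h1).trans ?_
    rw [hd, show 2 * a + 2 - 2 = 2 * a by omega, windmillEdges_eq _ (by omega)]
    exact Nat.add_le_add (Nat.mul_le_mul_left _ (blockEdges_le_exK (by omega) (by omega)))
      (blockEdges_le_exK (by omega) (by omega))
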